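/- Let n be a natural number, c : Fin n → ℝ with c_l > 0 for every l, and h : Fin n → ℝ. Define f(d) = sSup { Σ_l h_l·γ_l : γ ∈ ℝ^n, 0 ≤ γ_l ≤ 1 for all l, Σ_l c_l·γ_l = d } for d ∈ [0, Σ_l c_l]. Then for all d¹, d² ∈ [0, Σ_l c_l] and all λ ∈ [0,1], the convex combination point satisfies f(λ·d¹ + (1−λ)·d²) ≥ min(f(d¹), f(d²)); in particular f is quasiconcave on [0, Σ_l c_l]. -/

import Mathlib

/-- The objective values attained by the fractional allocations of total cost `d`. -/
def attainableValues {n : ℕ} (c h : Fin n → ℝ) (d : ℝ) : Set ℝ :=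
  { x : ℝ | ∃ γ : Fin n → ℝ,
    (∀ l, 0 ≤ γ l ∧ γ l ≤ 1) ∧ (∑ l, c l * γ l) = d ∧ x = ∑ l, h l * γ l }

theorem attainableValues_bddAbove {n : ℕ} (c h : Fin n → ℝ) (d : ℝ) :
    BddAbove (attainableValues c h d) := by
  refine ⟨∑ l, |h l|, ?_⟩
  rintro x ⟨γ, hγ, -, rfl⟩
  refine Finset.sum_le_sum fun l _ => ?_
  calc h l * γ l ≤ |h l| * γ l := mul_le_mul_of_nonneg_right (le_abs_self _) (hγ l).1
    _ ≤ |h l| := mul_le_of_le_one_right (abs_nonneg _) (hγ l).2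

theorem attainableValues_nonempty {n : ℕ} (c h : Fin n → ℝ) {d : ℝ}
    (hd : d ∈ Set.Icc (0 : ℝ) (∑ l, c l)) : (attainableValues c h d).Nonempty := by
  have hC : 0 ≤ ∑ l, c l := hd.1.trans hd.2
  refine ⟨_, fun _ => d / ∑ l, c l,
    fun _ => ⟨div_nonneg hd.1 hC, div_le_one_of_le₀ hd.2 hC⟩, ?_, rfl⟩
  rw [← Finset.sum_mul]
  refine mul_div_cancel_of_imp' fun h0 => ?_
  exact le_antisymm (h0 ▸ hd.2) hd.1

theorem attainableValues_convexCombination {n : ℕ} {c h : Fin n → ℝ} {d₁ d₂ x y a b : ℝ}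
    (hx : x ∈ attainableValues c h d₁) (hy : y ∈ attainableValues c h d₂)
    (ha : 0 ≤ a) (hb : 0 ≤ b) (hab : a + b = 1) :
    a * x + b * y ∈ attainableValues c h (a * d₁ + b * d₂) := by
  obtain ⟨γ, hγ, rfl, rfl⟩ := hx
  obtain ⟨δ, hδ, rfl, rfl⟩ := hy
  have sum_eq (w : Fin n → ℝ) :
      ∑ l, w l * (a * γ l + b * δ l) = a * ∑ l, w l * γ l + b * ∑ l, w l * δ l := by
    rw [Finset.mul_sum, Finset.mul_sum, ← Finset.sum_add_distrib]
    exact Finset.sum_congr rfl fun l _ => by ring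
  refine ⟨fun l => a * γ l + b * δ l, fun l => ⟨?_, ?_⟩, sum_eq c, (sum_eq h).symm⟩
  · exact add_nonneg (mul_nonneg ha (hγ l).1) (mul_nonneg hb (hδ l).1)
  · exact convex_Iic (1 : ℝ) (hγ l).2 (hδ l).2 ha hb hab

/-- Quasiconcavity of the utility function, a direct consequence of
Theorem 1 of the paper: for all `d¹, d² ∈ [0, ∑ l, c l]` and `λ ∈ [0,1]`,
`f(λ·d¹ + (1−λ)·d²) ≥ min (f d¹) (f d²)`. -/
theorem utility_quasiconcave
    (n : ℕ) (c h : Fin n → ℝ) (hc : ∀ l, 0 < c l)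
    (f : ℝ → ℝ)
    (hf : ∀ d : ℝ, f d =
      sSup { x : ℝ | ∃ γ : Fin n → ℝ,
        (∀ l, 0 ≤ γ l ∧ γ l ≤ 1) ∧
        (∑ l, c l * γ l) = d ∧
        x = ∑ l, h l * γ l }) :
    ∀ d₁ d₂ lam : ℝ,
      d₁ ∈ Set.Icc (0 : ℝ) (∑ l, c l) →
      d₂ ∈ Set.Icc (0 : ℝ) (∑ l, c l) →
      lam ∈ Set.Icc (0 : ℝ) 1 →
      min (f d₁) (f d₂) ≤ f (lam * d₁ + (1 - lam) * d₂) := by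
  intro d₁ d₂ lam hd₁ hd₂ hlam
  have hf' (d : ℝ) : f d = sSup (attainableValues c h d) := hf d
  refine le_of_forall_lt fun t ht => ?_
  rw [hf', hf', lt_min_iff] at ht
  obtain ⟨x, hx, htx⟩ := exists_lt_of_lt_csSup (attainableValues_nonempty c h hd₁) ht.1
  obtain ⟨y, hy, hty⟩ := exists_lt_of_lt_csSup (attainableValues_nonempty c h hd₂) ht.2
  have hlam' : 0 ≤ 1 - lam := sub_nonneg.2 hlam.2
  have hsum : lam + (1 - lam) = 1 := add_sub_cancel _ _
  have hlt : t < lam * x + (1 - lam) * y :=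
    convex_Ioi t htx hty hlam.1 hlam' hsum
  rw [hf']
  exact hlt.trans_le (le_csSup (attainableValues_bddAbove c h _)
    (attainableValues_convexCombination hx hy hlam.1 hlam' hsum))
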